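/- Let D be a finite-dimensional division algebra over a field R, with center E, and let d be the reduced dimension of D over E (so dim_E D = d²). Then dim_R D = d² · [E : R], and for any simple D-module (necessarily D itself), the length of the R^ac-module D ⊗_R R^ac as a module over the ring D ⊗_R R^ac is d · [E : R] when R^ac is an algebraic closure of R and E/R is separable. -/

import Mathlib

open TensorProduct Module

section TensorDivisionRing

variable {E K D : Type*} [Field E] [Field K] [Algebra E K] [DivisionRing D] [Algebra E D]

lemma TensorProduct.equivFinsuppOfBasisLeft_mul_one_tmul {ι : Type*} [DecidableEq ι]
    (b : Basis ι E K) (x : K ⊗[E] D) (c : D) (i : ι) :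
    equivFinsuppOfBasisLeft b (x * 1 ⊗ₜ c) i = equivFinsuppOfBasisLeft b x i * c := by
  induction x with
  | zero => simp
  | tmul k c => simp
  | add x y hx hy => rw [add_mul, map_add, Finsupp.add_apply, hx, hy, map_add,
      Finsupp.add_apply, add_mul]

lemma TensorProduct.equivFinsuppOfBasisLeft_one_tmul_mul {ι : Type*} [DecidableEq ι]
    (b : Basis ι E K) (x : K ⊗[E] D) (c : D) (i : ι) :
    equivFinsuppOfBasisLeft b (1 ⊗ₜ c * x) i = c * equivFinsuppOfBasisLeft b x i := by
  induction x with
  | zero => simp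
  | tmul k c => simp
  | add x y hx hy => rw [mul_add, map_add, Finsupp.add_apply, hx, hy, map_add,
      Finsupp.add_apply, mul_add]

/-- A tensor whose coordinates are all scalars is a pure tensor `k ⊗ₜ 1`. -/
lemma TensorProduct.exists_eq_tmul_one_of_coord_mem_bot {ι : Type*} [DecidableEq ι]
    (b : Basis ι E K) (x : K ⊗[E] D)
    (hx : ∀ i, equivFinsuppOfBasisLeft b x i ∈ (⊥ : Subalgebra E D)) :
    ∃ k : K, x = k ⊗ₜ 1 := by
  simp only [Algebra.mem_bot, Set.mem_range] at hx
  choose e he using hx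
  refine ⟨(equivFinsuppOfBasisLeft b x).sum fun i _ ↦ e i • b i, ?_⟩
  conv_lhs => rw [← (equivFinsuppOfBasisLeft b).symm_apply_apply x]
  rw [equivFinsuppOfBasisLeft_symm_apply, Finsupp.sum, Finsupp.sum, sum_tmul]
  refine Finset.sum_congr rfl fun i _ ↦ ?_
  rw [← he i, Algebra.algebraMap_eq_smul_one, smul_tmul]

/-- A nonzero two-sided ideal of `K ⊗[E] D` contains a unit: shorten a nonzero element of the
ideal by taking commutators with elements of `D`. -/
lemma TwoSidedIdeal.one_mem_of_mem_tensorProduct (hD : Subalgebra.center E D = ⊥)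
    (I : TwoSidedIdeal (K ⊗[E] D)) {x : K ⊗[E] D} (hx : x ∈ I) (hx0 : x ≠ 0) : 1 ∈ I := by
  classical
  let b := Basis.ofVectorSpace E K
  let φ := TensorProduct.equivFinsuppOfBasisLeft (N := D) b
  induction hn : (φ x).support.card using Nat.strong_induction_on generalizing x with
  | _ n ih =>
  obtain ⟨i, hi⟩ : ∃ i, φ x i ≠ 0 := by
    by_contra! h
    exact hx0 (φ.map_eq_zero_iff.1 (Finsupp.ext h))
  let y := x * 1 ⊗ₜ (φ x i)⁻¹
  have hφy (j) : φ y j = φ x j * (φ x i)⁻¹ := equivFinsuppOfBasisLeft_mul_one_tmul b x _ j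
  have hyi : φ y i = 1 := by rw [hφy, mul_inv_cancel₀ hi]
  have hy : y ∈ I := I.mul_mem_right _ _ hx
  by_cases h : ∀ j, φ y j ∈ (⊥ : Subalgebra E D)
  · obtain ⟨k, hk⟩ := exists_eq_tmul_one_of_coord_mem_bot b y h
    have hk0 : k ≠ 0 := by
      rintro rfl
      rw [hk] at hyi
      simp at hyi
    have h1 := I.mul_mem_left (k⁻¹ ⊗ₜ 1) _ hy
    rwa [hk, Algebra.TensorProduct.tmul_mul_tmul, inv_mul_cancel₀ hk0, one_mul] at h1
  · simp only [← hD, Subalgebra.mem_center_iff, not_forall] at h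
    obtain ⟨j, c, hc⟩ := h
    let z := 1 ⊗ₜ c * y - y * 1 ⊗ₜ c
    have hφz (l) : φ z l = c * φ y l - φ y l * c := by
      rw [map_sub, Finsupp.sub_apply]
      exact congrArg₂ _ (equivFinsuppOfBasisLeft_one_tmul_mul b y c l)
        (equivFinsuppOfBasisLeft_mul_one_tmul b y c l)
    refine ih _ ?_ (I.sub_mem (I.mul_mem_left _ _ hy) (I.mul_mem_right _ _ hy)) (x := z) ?_ rfl
    · rw [← hn]
      refine Finset.card_lt_card (Finset.ssubset_iff_subset_ne.2 ⟨fun l hl ↦ ?_, fun h ↦ ?_⟩)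
      · rw [Finsupp.mem_support_iff] at hl ⊢
        exact fun h0 ↦ hl (by simp [hφz, hφy, h0])
      · have := h ▸ Finsupp.mem_support_iff.2 hi
        rw [Finsupp.mem_support_iff, hφz, hyi] at this
        simp at this
    · intro hz
      have := hφz j
      rw [hz, map_zero, Finsupp.zero_apply] at this
      exact hc (sub_eq_zero.1 this.symm)

lemma isSimpleRing_tensorProduct (hD : Subalgebra.center E D = ⊥) :
    IsSimpleRing (K ⊗[E] D) := by
  refine ⟨⟨fun I ↦ or_iff_not_imp_left.2 fun hI ↦ ?_⟩⟩
  obtain ⟨x, hx, hx0⟩ : ∃ x ∈ I, x ≠ 0 := by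
    by_contra! h
    exact hI (eq_bot_iff.2 fun x hx ↦ (TwoSidedIdeal.mem_bot _).2 (h x hx))
  exact (TwoSidedIdeal.one_mem_iff I).1 (I.one_mem_of_mem_tensorProduct hD hx hx0)

lemma exists_tensorProduct_algEquiv_matrix [FiniteDimensional E D] [IsAlgClosed K]
    (hD : Subalgebra.center E D = ⊥) {d : ℕ} (hdim : finrank E D = d ^ 2) :
    Nonempty (K ⊗[E] D ≃ₐ[K] Matrix (Fin d) (Fin d) K) := by
  have := isSimpleRing_tensorProduct (K := K) hD
  obtain ⟨n, -, ⟨e⟩⟩ := IsSimpleRing.exists_algEquiv_matrix_of_isAlgClosed K (K ⊗[E] D)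
  have h := e.toLinearEquiv.finrank_eq
  rw [finrank_baseChange, hdim, finrank_matrix] at h
  simp only [Fintype.card_fin, finrank_self, mul_one, ← sq] at h
  obtain rfl : d = n := Nat.pow_left_injective two_ne_zero h
  exact ⟨e⟩

end TensorDivisionRing

section Embeddings

variable {R E K D : Type*} [Field R] [Field E] [Field K] [Algebra R E] [Algebra R K]
  [DivisionRing D] [Algebra R D] [Algebra E D]

lemma exists_algHom_matrix_of_algHom [IsScalarTower R E D] [FiniteDimensional E D]
    [IsAlgClosed K] (hD : Subalgebra.center E D = ⊥) {d : ℕ} (hdim : finrank E D = d ^ 2)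
    (σ : E →ₐ[R] K) :
    ∃ g : K ⊗[R] D →ₐ[K] Matrix (Fin d) (Fin d) K, Function.Surjective g ∧
      ∀ e : E, g (1 ⊗ₜ algebraMap E D e) = algebraMap K _ (σ e) := by
  algebraize [σ.toRingHom]
  have : IsScalarTower R E K := .of_algebraMap_eq fun r ↦ (σ.commutes r).symm
  obtain ⟨ψ⟩ := exists_tensorProduct_algEquiv_matrix (K := K) hD hdim
  refine ⟨ψ.toAlgHom.comp (Algebra.TensorProduct.mapOfCompatibleSMul E R K K D),
    ψ.surjective.comp (Algebra.TensorProduct.mapOfCompatibleSMul_surjective E R K K D),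
    fun e ↦ ?_⟩
  have h : (1 : K) ⊗ₜ[E] algebraMap E D e = algebraMap K _ (σ e) := by
    rw [Algebra.algebraMap_eq_smul_one, ← smul_tmul, Algebra.smul_def, mul_one]
    rfl
  change ψ (1 ⊗ₜ[E] algebraMap E D e) = _
  rw [h, AlgEquiv.commutes]

/-- If each `g σ` is surjective and restricts to `σ` on `E`, then the `g σ` are jointly surjective,
by linear independence of the embeddings `σ`. -/
lemma pi_surjective_of_algHom [FiniteDimensional R E] {B : Type*} [Ring B] [Algebra K B]
    (g : (E →ₐ[R] K) → K ⊗[R] D →ₐ[K] B) (hg : ∀ σ, Function.Surjective (g σ))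
    (hgE : ∀ σ (e : E), g σ (1 ⊗ₜ algebraMap E D e) = algebraMap K B (σ e)) :
    Function.Surjective (AlgHom.pi g) := by
  classical
  have hspan (w : (E →ₐ[R] K) → K) :
      ∃ x : K ⊗[R] D, ∀ σ, g σ x = algebraMap K B (w σ) := by
    have hli : LinearIndependent K fun (σ : E →ₐ[R] K) (e : E) ↦ σ e :=
      (linearIndependent_monoidHom E K).comp (fun σ : E →ₐ[R] K ↦ (σ : E →* K))
        fun σ τ h ↦ AlgHom.ext fun e ↦ DFunLike.congr_fun h e
    have hw : w ∈ Submodule.span K (Set.range (flip fun (σ : E →ₐ[R] K) (e : E) ↦ σ e)) :=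
      span_flip_eq_top_iff_linearIndependent.2 hli ▸ Submodule.mem_top
    induction hw using Submodule.span_induction with
    | mem w hw =>
      obtain ⟨e, rfl⟩ := hw
      exact ⟨_, fun σ ↦ hgE σ e⟩
    | zero => exact ⟨0, by simp⟩
    | add v w _ _ hv hw =>
      obtain ⟨x, hx⟩ := hv
      obtain ⟨y, hy⟩ := hw
      exact ⟨x + y, fun σ ↦ by simp [hx, hy]⟩
    | smul k w _ hw =>
      obtain ⟨x, hx⟩ := hw
      exact ⟨k • x, fun σ ↦ by
        rw [map_smul, hx, Pi.smul_apply, smul_eq_mul, map_mul, Algebra.smul_def]⟩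
  intro m
  choose x hx using fun σ ↦ hg σ (m σ)
  choose c hc using fun σ ↦ hspan (Pi.single σ 1)
  refine ⟨∑ σ, c σ * x σ, funext fun τ ↦ ?_⟩
  simp only [AlgHom.pi_apply, map_sum, map_mul, hc]
  rw [Finset.sum_eq_single τ (fun σ _ h ↦ by simp [Pi.single_eq_of_ne h.symm]) (by simp)]
  simp [hx]

end Embeddings

section Length

lemma Module.length_self_of_bijective_smul {A I : Type*} [Ring A] [Fintype I] {d : ℕ}
    {M : I → Type*} [∀ i, AddCommGroup (M i)] [hM : ∀ i, Module A (M i)]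
    (hs : ∀ i, IsSimpleModule A (M i)) (v : ∀ i, Fin d → M i)
    (hv : Function.Bijective fun (a : A) i j ↦ a • v i j) :
    length A A = Fintype.card I * d := by
  let f : A →ₗ[A] ∀ i, Fin d → M i := LinearMap.toSpanSingleton A _ v
  rw [(LinearEquiv.ofBijective f hv).length_eq, length_pi_of_fintype]
  simp [length_pi_of_fintype, length_eq_one]

lemma Module.length_self_of_ringEquiv_pi_matrix {A K I : Type*} [Ring A] [Field K] [Fintype I]
    {d : ℕ} [NeZero d] (f : A ≃+* (I → Matrix (Fin d) (Fin d) K)) :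
    length A A = Fintype.card I * d := by
  let F (i : I) : A →+* Module.End K (Fin d → K) :=
    (Matrix.toLinAlgEquiv' (R := K) (n := Fin d) : _ →+* _).comp
      ((Pi.evalRingHom _ i).comp f.toRingHom)
  have hF (i a) (w : Fin d → K) : F i a w = (f a i).mulVec w := rfl
  have hsurj (i) : Function.Surjective (F i) :=
    Matrix.toLinAlgEquiv'.surjective.comp ((Function.surjective_eval i).comp f.surjective)
  refine length_self_of_bijective_smul (M := fun _ ↦ Fin d → K)
    (hM := fun i ↦ Module.compHom _ (F i)) (fun i ↦ ?_) (fun _ j ↦ Pi.single j 1) ?_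
  · let := Module.compHom (Fin d → K) (F i)
    refine isSimpleModule_iff_toSpanSingleton_surjective.2 ⟨inferInstance, fun x hx y ↦ ?_⟩
    obtain ⟨T, hT⟩ := IsSimpleModule.toSpanSingleton_surjective (Module.End K (Fin d → K)) hx y
    obtain ⟨a, rfl⟩ := hsurj i T
    exact ⟨a, hT⟩
  · have h : (fun (a : A) (i : I) (j : Fin d) ↦ F i a (Pi.single j 1)) =
        (fun m i ↦ (m i).transpose) ∘ f := by
      ext a i j k
      simp [hF]
    change Function.Bijective fun (a : A) (i : I) (j : Fin d) ↦ F i a (Pi.single j 1)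
    rw [h]
    refine Function.Bijective.comp ?_ f.bijective
    exact Function.Involutive.bijective fun m ↦ funext fun i ↦ (m i).transpose_transpose

end Length

/-- Let `D` be a division algebra, finite-dimensional over a field `R`, with center the
field `E` (`R ⊆ E ⊆ D`) and reduced dimension `d` (so `dim_E D = d²`), with `E/R`
separable. Then `dim_R D = d² · [E : R]`, and the scalar extension `R^ac ⊗_R D` has
length `d · [E : R]` as a module over itself (expressed by a composition series from
`⊥` to `⊤` of that length). -/
theorem division_algebra_dim_and_length_of_scalar_extension
    (R : Type*) [Field R]
    (E : Type*) [Field E] [Algebra R E] [Algebra.IsSeparable R E] [FiniteDimensional R E]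
    (D : Type*) [DivisionRing D] [Algebra R D] [Algebra E D] [IsScalarTower R E D]
    [FiniteDimensional R D]
    (hcentral : Subalgebra.center E D = ⊥)
    (d : ℕ) (hd : 0 < d) (hdim : Module.finrank E D = d ^ 2) :
    Module.finrank R D = d ^ 2 * Module.finrank R E ∧
    ∃ s : CompositionSeries (Submodule (AlgebraicClosure R ⊗[R] D)
        (AlgebraicClosure R ⊗[R] D)),
      s.head = ⊥ ∧ s.last = ⊤ ∧ s.length = d * Module.finrank R E := by
  have hfin : finrank R D = d ^ 2 * finrank R E := by
    rw [← finrank_mul_finrank R E D, hdim, mul_comm]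
  refine ⟨hfin, ?_⟩
  have : FiniteDimensional E D := .right R E D
  have : NeZero d := ⟨hd.ne'⟩
  let K := AlgebraicClosure R
  choose g hg hgE using exists_algHom_matrix_of_algHom (R := R) (K := K) hcentral hdim
  have hsurj := pi_surjective_of_algHom g hg hgE
  have hrank : finrank K (K ⊗[R] D) =
      finrank K ((E →ₐ[R] K) → Matrix (Fin d) (Fin d) K) := by
    rw [finrank_baseChange, hfin, finrank_pi_fintype]
    simp [finrank_matrix, AlgHom.card, sq, mul_comm]
  have hinj : Function.Injective (AlgHom.pi g) :=
    (LinearMap.injective_iff_surjective_of_finrank_eq_finrank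
      (f := (AlgHom.pi g).toLinearMap) hrank).2 hsurj
  have hlen := length_self_of_ringEquiv_pi_matrix (AlgEquiv.ofBijective _ ⟨hinj, hsurj⟩).toRingEquiv
  have : IsNoetherian (K ⊗[R] D) (K ⊗[R] D) := IsNoetherianRing.of_finite K _
  have : IsArtinian (K ⊗[R] D) (K ⊗[R] D) := IsArtinianRing.of_finite K _
  obtain ⟨s, hs, hs'⟩ :=
    exists_compositionSeries_of_isNoetherian_isArtinian (K ⊗[R] D) (K ⊗[R] D)
  refine ⟨s, hs, hs', ?_⟩
  rw [← length_compositionSeries s hs hs', AlgHom.card, mul_comm] at hlen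
  exact_mod_cast hlen
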